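/- (Identification of the diffusion coefficient.) Let α ∈ [0,1]. For every continuous function ψ : ℝ → ℝ with compact support, lim_{t→0+} ∫_ℝ ψ(x)·(1/t)·(∫_ℝ q_α(t,x,y)·(y−x)² dy) dx = ∫_ℝ ψ(x) dx. -/

import Mathlib

open MeasureTheory Real Filter

/-- The Gaussian heat kernel `p(t,x,y) = (2πt)^{-1/2} exp(-(x-y)²/(2t))`. -/
noncomputable def heatKernel (t x y : ℝ) : ℝ :=
  (Real.sqrt (2 * Real.pi * t))⁻¹ * Real.exp (-(x - y) ^ 2 / (2 * t))

/-- The transition kernel of the Skew Brownian motion of parameter `α`: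
`q_α(t,x,y) = p(t,x,y) + (2α-1)·sgn(y)·(2πt)^{-1/2} exp(-(|x|+|y|)²/(2t))`. -/
noncomputable def skewKernel (α t x y : ℝ) : ℝ :=
  heatKernel t x y +
    (2 * α - 1) * Real.sign y * (Real.sqrt (2 * Real.pi * t))⁻¹ *
      Real.exp (-(|x| + |y|) ^ 2 / (2 * t))

/-- The variance of the Gaussian heat kernel at time `t` is `t`. -/
lemma integral_heatKernel_mul_sq {t : ℝ} (ht : 0 < t) (x : ℝ) :
    ∫ y, heatKernel t x y * (y - x) ^ 2 = t := by
  have hv : t.toNNReal ≠ 0 := (Real.toNNReal_pos.mpr ht).ne'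
  have h := ProbabilityTheory.variance_id_gaussianReal (μ := x) (v := t.toNNReal)
  rw [ProbabilityTheory.variance_eq_integral aemeasurable_id] at h
  simp only [id, ProbabilityTheory.integral_id_gaussianReal] at h
  rw [ProbabilityTheory.integral_gaussianReal_eq_integral_smul hv,
    Real.coe_toNNReal t ht.le] at h
  refine Eq.trans ?_ h
  refine integral_congr_ae (Eventually.of_forall fun y => ?_)
  simp only [heatKernel, ProbabilityTheory.gaussianPDFReal, smul_eq_mul,
    Real.coe_toNNReal t ht.le]
  rw [sub_sq_comm x y]

lemma integrable_heatKernel_mul_sq {t : ℝ} (ht : 0 < t) (x : ℝ) :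
    Integrable fun y => heatKernel t x y * (y - x) ^ 2 := by
  by_contra h
  exact ht.ne (by rw [← integral_heatKernel_mul_sq ht x, integral_undef h])

lemma measurable_real_sign : Measurable Real.sign :=
  Measurable.ite measurableSet_Iio measurable_const
    (Measurable.ite measurableSet_Ioi measurable_const measurable_const)

lemma abs_real_sign_le_one (y : ℝ) : |Real.sign y| ≤ 1 := by
  rcases Real.sign_apply_eq y with h | h | h <;> simp [h]

lemma measurable_skewKernel (α t : ℝ) :
    Measurable fun z : ℝ × ℝ => skewKernel α t z.1 z.2 := by
  have h : Measurable fun z : ℝ × ℝ => Real.sign z.2 :=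
    measurable_real_sign.comp measurable_snd
  unfold skewKernel heatKernel
  refine Measurable.add (by fun_prop) ?_
  exact ((h.const_mul _).mul_const _).mul (by fun_prop)

/-- Pointwise Gaussian bound on the skew part of the kernel weighted by `(y - x) ^ 2`. -/
lemma abs_skewKernel_sub_heatKernel_mul_sq_le {α : ℝ} (hα : α ∈ Set.Icc (0 : ℝ) 1) {t : ℝ}
    (ht : 0 < t) (x y : ℝ) :
    |(skewKernel α t x y - heatKernel t x y) * (y - x) ^ 2| ≤
      4 * t * (√(2 * π * t))⁻¹ * exp (-x ^ 2 / (4 * t)) * exp (-(1 / (4 * t)) * y ^ 2) := by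
  have hα' : |2 * α - 1| ≤ 1 := abs_le.mpr ⟨by linarith [hα.1], by linarith [hα.2]⟩
  have hcs : |(2 * α - 1) * Real.sign y| ≤ 1 := by
    rw [abs_mul]
    exact mul_le_one₀ hα' (abs_nonneg _) (abs_real_sign_le_one y)
  set r := |x| + |y| with hr
  have hr0 : 0 ≤ r := by positivity
  have hsq : (y - x) ^ 2 ≤ r ^ 2 := by
    rw [← sq_abs (y - x)]
    have : |y - x| ≤ r := by rw [hr, add_comm]; exact abs_sub y x
    gcongr
  have hxy : x ^ 2 + y ^ 2 ≤ r ^ 2 := by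
    rw [hr, ← sq_abs x, ← sq_abs y]
    nlinarith [abs_nonneg x, abs_nonneg y, mul_nonneg (abs_nonneg x) (abs_nonneg y)]
  set u := r ^ 2 / (4 * t) with hu
  have hru : r ^ 2 = 4 * t * u := by rw [hu]; field_simp
  have hue : u * exp (-u) ≤ 1 := by
    have h1 : u ≤ exp u := by linarith [add_one_le_exp u]
    calc u * exp (-u) ≤ exp u * exp (-u) := by gcongr
      _ = 1 := by rw [← exp_add]; simp
  have hsplit : exp (-r ^ 2 / (2 * t)) = exp (-u) * exp (-u) := by
    rw [← exp_add, hu]; congr 1; field_simp; ring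
  have hexp : exp (-u) ≤ exp (-x ^ 2 / (4 * t)) * exp (-(1 / (4 * t)) * y ^ 2) := by
    rw [← exp_add, exp_le_exp, hu]
    have : -x ^ 2 / (4 * t) + -(1 / (4 * t)) * y ^ 2 = -((x ^ 2 + y ^ 2) / (4 * t)) := by ring
    rw [this]
    gcongr
  have hK : (skewKernel α t x y - heatKernel t x y) * (y - x) ^ 2 =
      ((2 * α - 1) * Real.sign y) *
        ((√(2 * π * t))⁻¹ * exp (-r ^ 2 / (2 * t)) * (y - x) ^ 2) := by
    unfold skewKernel; ring
  rw [hK, abs_mul, abs_of_nonneg (a := (√(2 * π * t))⁻¹ * _ * _) (by positivity)]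
  calc _ ≤ 1 * ((√(2 * π * t))⁻¹ * exp (-r ^ 2 / (2 * t)) * r ^ 2) := by gcongr
    _ = 4 * t * (√(2 * π * t))⁻¹ * (u * exp (-u)) * exp (-u) := by rw [hsplit, hru]; ring
    _ ≤ 4 * t * (√(2 * π * t))⁻¹ * 1 *
        (exp (-x ^ 2 / (4 * t)) * exp (-(1 / (4 * t)) * y ^ 2)) := by gcongr
    _ = _ := by ring

/-- The rescaled second moment of the skew kernel is `1` up to a Gaussian error in `x / √t`. -/
lemma abs_integral_skewKernel_mul_sq_sub_one_le {α : ℝ} (hα : α ∈ Set.Icc (0 : ℝ) 1) {t : ℝ}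
    (ht : 0 < t) (x : ℝ) :
    |(1 / t) * (∫ y, skewKernel α t x y * (y - x) ^ 2) - 1| ≤
      4 * √2 * exp (-x ^ 2 / (4 * t)) := by
  have hb : 0 < 1 / (4 * t) := by positivity
  have hg := (integrable_exp_neg_mul_sq hb).const_mul
    (4 * t * (√(2 * π * t))⁻¹ * exp (-x ^ 2 / (4 * t)))
  have hle := fun y => abs_skewKernel_sub_heatKernel_mul_sq_le hα ht x y
  have hs : Measurable fun y => skewKernel α t x y :=
    Measurable.of_uncurry_left (f := skewKernel α t) (measurable_skewKernel α t)
  have hh : Measurable fun y => heatKernel t x y := by unfold heatKernel; fun_prop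
  have hi : Integrable fun y => (skewKernel α t x y - heatKernel t x y) * (y - x) ^ 2 :=
    hg.mono' ((hs.sub hh).mul (by fun_prop)).aestronglyMeasurable (Eventually.of_forall hle)
  have hsum : ∫ y, skewKernel α t x y * (y - x) ^ 2 =
      t + ∫ y, (skewKernel α t x y - heatKernel t x y) * (y - x) ^ 2 := by
    have h := integral_add (integrable_heatKernel_mul_sq ht x) hi
    rw [integral_heatKernel_mul_sq ht x] at h
    rw [← h]
    congr 1 with y
    ring
  have hsqrt : √(π / (1 / (4 * t))) = √2 * √(2 * π * t) := by
    rw [← Real.sqrt_mul (by norm_num)]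
    congr 1; field_simp; ring
  have hpos : 0 < √(2 * π * t) := by positivity
  have hI : |∫ y, (skewKernel α t x y - heatKernel t x y) * (y - x) ^ 2| ≤
      t * (4 * √2 * exp (-x ^ 2 / (4 * t))) := by
    refine (norm_integral_le_of_norm_le
      (f := fun y => (skewKernel α t x y - heatKernel t x y) * (y - x) ^ 2) hg
      (Eventually.of_forall hle)).trans_eq ?_
    rw [integral_const_mul, integral_gaussian, hsqrt]
    field_simp
  rw [hsum, mul_add, one_div_mul_cancel ht.ne', add_sub_cancel_left, abs_mul,
    abs_of_pos (by positivity), one_div, inv_mul_le_iff₀ ht]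
  exact hI

lemma tendsto_exp_neg_sq_div_nhdsGT_zero {x : ℝ} (hx : x ≠ 0) :
    Tendsto (fun t => exp (-x ^ 2 / (4 * t))) (nhdsWithin 0 (Set.Ioi 0)) (nhds 0) := by
  have hx2 : -x ^ 2 / 4 < 0 := by
    have : 0 < x ^ 2 := by positivity
    linarith
  refine tendsto_exp_atBot.comp ((tendsto_inv_nhdsGT_zero.const_mul_atTop_of_neg hx2).congr ?_)
  intro t
  rw [div_mul_eq_div_div, div_eq_mul_inv _ t]

theorem skewKernel_diffusion_coefficient (α : ℝ) (hα : α ∈ Set.Icc (0 : ℝ) 1)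
    (ψ : ℝ → ℝ) (hψc : Continuous ψ) (hψs : HasCompactSupport ψ) :
    Tendsto
      (fun t => ∫ x, ψ x * ((1 / t) * ∫ y, skewKernel α t x y * (y - x) ^ 2))
      (nhdsWithin 0 (Set.Ioi 0)) (nhds (∫ x, ψ x)) := by
  have hψi : Integrable ψ := hψc.integrable_of_hasCompactSupport hψs
  refine tendsto_integral_filter_of_dominated_convergence
    (fun x => ‖ψ x‖ * (1 + 4 * √2)) ?_ ?_ (hψi.norm.mul_const _) ?_
  · refine Eventually.of_forall fun t => ?_
    have hm : StronglyMeasurable fun z : ℝ × ℝ => skewKernel α t z.1 z.2 * (z.2 - z.1) ^ 2 :=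
      ((measurable_skewKernel α t).mul (by fun_prop)).stronglyMeasurable
    exact (hψc.stronglyMeasurable.mul
      (stronglyMeasurable_const.mul hm.integral_prod_right')).aestronglyMeasurable
  · filter_upwards [self_mem_nhdsWithin] with t ht
    refine Eventually.of_forall fun x => ?_
    have ht : 0 < t := ht
    rw [norm_mul]
    gcongr
    have h := abs_integral_skewKernel_mul_sq_sub_one_le hα ht x
    have he : exp (-x ^ 2 / (4 * t)) ≤ 1 := by
      rw [exp_le_one_iff, neg_div, neg_nonpos]; positivity
    have h4 : 4 * √2 * exp (-x ^ 2 / (4 * t)) ≤ 4 * √2 :=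
      mul_le_of_le_one_right (by positivity) he
    have hab := abs_le.mp (h.trans h4)
    rw [Real.norm_eq_abs, abs_le]
    constructor <;> linarith [hab.1, hab.2]
  · filter_upwards [Measure.ae_ne volume (0 : ℝ)] with x hx
    have hlim : Tendsto (fun t => (1 / t) * ∫ y, skewKernel α t x y * (y - x) ^ 2)
        (nhdsWithin 0 (Set.Ioi 0)) (nhds 1) := by
      rw [tendsto_iff_norm_sub_tendsto_zero]
      refine squeeze_zero' (Eventually.of_forall fun t => norm_nonneg _) ?_
        (by simpa using (tendsto_exp_neg_sq_div_nhdsGT_zero hx).const_mul (4 * √2))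
      filter_upwards [self_mem_nhdsWithin] with t ht
      exact abs_integral_skewKernel_mul_sq_sub_one_le hα ht x
    simpa using hlim.const_mul (ψ x)
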